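/- Let X be a real-valued random variable with continuous distribution function F(·;X), and let W be a square-integrable real-valued random variable on the same probability space. Then the conditional expectation has the LP representation E[W | σ(X)] = E[W] + ∑_{j≥1} E[W · Leg_j(F(X;X))] · Leg_j(F(X;X)), where the series converges in L²(P). -/

import Mathlib

open MeasureTheory Set Filter

/-- The `j`-th orthonormal shifted Legendre polynomial on `[0,1]`, i.e. the result of
Gram–Schmidt orthonormalization of the monomials `1, u, u², …` in
`L²([0,1])` (Rodrigues' formula): `Leg j u = √(2j+1)/j! · dʲ/duʲ (u²−u)ʲ`.
In particular `Leg 0 = 1` and `Leg 1 u = √12 (u − 1/2)`. -/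
noncomputable def Leg (j : ℕ) (u : ℝ) : ℝ :=
  (Real.sqrt (2 * j + 1) / j.factorial) * iteratedDeriv j (fun x => (x ^ 2 - x) ^ j) u

/-- The distribution function `F(x;X) = P(X ≤ x)`. -/
noncomputable def distFun {Ω : Type*} [MeasurableSpace Ω] (P : Measure Ω)
    (X : Ω → ℝ) (x : ℝ) : ℝ :=
  (P (X ⁻¹' Iic x)).toReal


/-- Integration by parts on `[0,1]` for polynomials, when the
boundary terms vanish. -/
lemma integral_derivative_mul_eq_neg (p q : Polynomial ℝ)
    (h0 : (p * q).eval 0 = 0) (h1 : (p * q).eval 1 = 0) :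
    ∫ x in (0 : ℝ)..1, (Polynomial.derivative p * q).eval x =
      -∫ x in (0 : ℝ)..1, (p * Polynomial.derivative q).eval x := by
  have h := intervalIntegral.integral_eq_sub_of_hasDerivAt (a := 0) (b := 1)
    (f := fun x => (p * q).eval x) (fun x _ => (p * q).hasDerivAt x)
    ((p * q).derivative.continuous.intervalIntegrable _ _)
  rw [h0, h1, Polynomial.derivative_mul] at h
  simp only [Polynomial.eval_add] at h
  rw [intervalIntegral.integral_add (Polynomial.continuous _ |>.intervalIntegrable _ _)
    (Polynomial.continuous _ |>.intervalIntegrable _ _)] at h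
  linarith

/-- The Rodrigues polynomial `dʲ/duʲ (u² − u)ʲ`. -/
noncomputable def rodrigues (j : ℕ) : Polynomial ℝ :=
  Polynomial.derivative^[j] ((Polynomial.X ^ 2 - Polynomial.X) ^ j)

lemma eval_iterate_derivative_eq_zero {i j : ℕ} (hij : i < j) (x : ℝ) (hx : x ^ 2 - x = 0) :
    (Polynomial.derivative^[i]
      ((Polynomial.X ^ 2 - Polynomial.X : Polynomial ℝ) ^ j)).eval x = 0 := by
  obtain ⟨r, hr⟩ := Polynomial.pow_sub_dvd_iterate_derivative_pow
    (Polynomial.X ^ 2 - Polynomial.X : Polynomial ℝ) j i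
  rw [hr]
  simp [hx, Nat.sub_ne_zero_of_lt hij]

/-- Repeated integration by parts against a Rodrigues polynomial. -/
lemma integral_rodrigues_mul (j : ℕ) (q : Polynomial ℝ) :
    ∫ x in (0 : ℝ)..1, (rodrigues j * q).eval x =
      (-1) ^ j * ∫ x in (0 : ℝ)..1,
        ((Polynomial.X ^ 2 - Polynomial.X) ^ j * Polynomial.derivative^[j] q).eval x := by
  have key : ∀ i ≤ j, ∫ x in (0 : ℝ)..1, (rodrigues j * q).eval x =
      (-1) ^ i * ∫ x in (0 : ℝ)..1, (Polynomial.derivative^[j - i]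
        ((Polynomial.X ^ 2 - Polynomial.X) ^ j) * Polynomial.derivative^[i] q).eval x := by
    intro i
    induction i with
    | zero => intro _; simp [rodrigues]
    | succ i ih =>
      intro hi
      rw [ih (by omega), show j - i = (j - (i + 1)) + 1 by omega,
        Function.iterate_succ_apply', integral_derivative_mul_eq_neg,
        Function.iterate_succ_apply', pow_succ]
      · ring
      all_goals
        rw [Polynomial.eval_mul, eval_iterate_derivative_eq_zero (by omega) _ (by norm_num),
          zero_mul]
  simpa using key j le_rfl

lemma natDegree_X_sq_sub_X_pow (j : ℕ) :
    ((Polynomial.X ^ 2 - Polynomial.X : Polynomial ℝ) ^ j).natDegree = 2 * j := by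
  rw [Polynomial.natDegree_pow, show (Polynomial.X ^ 2 - Polynomial.X : Polynomial ℝ).natDegree = 2
    by compute_degree!, mul_comm]

lemma coeff_X_sq_sub_X_pow (j : ℕ) :
    ((Polynomial.X ^ 2 - Polynomial.X : Polynomial ℝ) ^ j).coeff (2 * j) = 1 := by
  have h : ((Polynomial.X ^ 2 - Polynomial.X : Polynomial ℝ) ^ j).Monic :=
    Polynomial.Monic.pow (by monicity!) j
  have := h.coeff_natDegree
  rwa [natDegree_X_sq_sub_X_pow] at this

lemma natDegree_rodrigues_le (j : ℕ) : (rodrigues j).natDegree ≤ j := by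
  refine (Polynomial.natDegree_iterate_derivative _ _).trans ?_
  rw [natDegree_X_sq_sub_X_pow]
  omega

lemma coeff_rodrigues_ne_zero (j : ℕ) : (rodrigues j).coeff j ≠ 0 := by
  rw [rodrigues, Polynomial.coeff_iterate_derivative, ← two_mul, coeff_X_sq_sub_X_pow]
  simp [Nat.descFactorial_eq_zero_iff_lt]
  omega

lemma degree_rodrigues (j : ℕ) : (rodrigues j).degree = j :=
  le_antisymm (Polynomial.natDegree_le_iff_degree_le.mp (natDegree_rodrigues_le j))
    (Polynomial.le_degree_of_ne_zero (coeff_rodrigues_ne_zero j))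

lemma iterate_derivative_rodrigues (j : ℕ) :
    Polynomial.derivative^[j] (rodrigues j) = Polynomial.C ((2 * j).factorial : ℝ) := by
  rw [rodrigues, ← Function.iterate_add_apply, ← two_mul]
  have h : (Polynomial.derivative^[2 * j]
      ((Polynomial.X ^ 2 - Polynomial.X : Polynomial ℝ) ^ j)).natDegree ≤ 0 := by
    refine (Polynomial.natDegree_iterate_derivative _ _).trans ?_
    rw [natDegree_X_sq_sub_X_pow]
    omega
  rw [Polynomial.eq_C_of_natDegree_le_zero h, Polynomial.coeff_iterate_derivative, zero_add,
    coeff_X_sq_sub_X_pow, Nat.descFactorial_self, nsmul_eq_mul, mul_one]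

/-- The Beta integral at natural numbers. -/
lemma integral_pow_mul_one_sub_pow (a b : ℕ) :
    ∫ x in (0 : ℝ)..1, x ^ a * (1 - x) ^ b =
      (a.factorial * b.factorial : ℝ) / (a + b + 1).factorial := by
  induction b generalizing a with
  | zero =>
    simp [integral_pow, Nat.factorial_succ]
    field_simp
  | succ b ih =>
    have h := integral_derivative_mul_eq_neg (Polynomial.X ^ (a + 1))
      ((1 - Polynomial.X) ^ (b + 1)) (by simp) (by simp)
    simp only [Polynomial.derivative_pow, Polynomial.eval_mul,
      Polynomial.eval_pow, Polynomial.eval_X, Polynomial.eval_sub, Polynomial.eval_one,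
      Polynomial.eval_C, Polynomial.derivative_sub, Polynomial.derivative_one,
      Polynomial.derivative_X, Nat.add_sub_cancel, zero_sub, Polynomial.eval_neg,
      mul_one] at h
    have e1 : ∀ x : ℝ, ((a + 1 : ℕ) : ℝ) * x ^ a * (1 - x) ^ (b + 1) =
      (a + 1 : ℝ) * (x ^ a * (1 - x) ^ (b + 1)) := fun x => by push_cast; ring
    have e2 : ∀ x : ℝ, x ^ (a + 1) * (((b + 1 : ℕ) : ℝ) * (1 - x) ^ b * -1) =
      -(b + 1 : ℝ) * (x ^ (a + 1) * (1 - x) ^ b) := fun x => by push_cast; ring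
    simp only [e1, e2, intervalIntegral.integral_const_mul, ih (a + 1)] at h
    have ha : (a + 1 : ℝ) ≠ 0 := by positivity
    rw [← mul_right_inj' ha, h, show a + 1 + b + 1 = a + (b + 1) + 1 by ring,
      Nat.factorial_succ a, Nat.factorial_succ b]
    push_cast
    ring

/-- The shifted Legendre polynomial `Leg j` as a polynomial. -/
noncomputable def legPoly (j : ℕ) : Polynomial ℝ :=
  Polynomial.C (Real.sqrt (2 * j + 1) / j.factorial) * rodrigues j

lemma Leg_eq_eval (j : ℕ) : Leg j = fun u => (legPoly j).eval u := by
  have h : ∀ (i : ℕ) (p : Polynomial ℝ), iteratedDeriv i (fun x => p.eval x) =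
      fun x => (Polynomial.derivative^[i] p).eval x := by
    intro i p
    induction i with
    | zero => simp
    | succ i ih =>
      rw [iteratedDeriv_succ, ih]
      ext x
      simp [Function.iterate_succ_apply', Polynomial.deriv]
  ext u
  have h' := congrFun (h j ((Polynomial.X ^ 2 - Polynomial.X) ^ j)) u
  simp only [Polynomial.eval_pow, Polynomial.eval_sub, Polynomial.eval_X] at h'
  rw [Leg, h', legPoly, rodrigues, Polynomial.eval_mul, Polynomial.eval_C]

lemma legPoly_zero : legPoly 0 = 1 := by
  simp [legPoly, rodrigues]

lemma degree_legPoly (j : ℕ) : (legPoly j).degree = j := by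
  have : Real.sqrt (2 * j + 1) / j.factorial ≠ 0 := by positivity
  rw [legPoly, Polynomial.degree_C_mul this, degree_rodrigues]

lemma integral_rodrigues_mul_self (j : ℕ) :
    ∫ x in (0 : ℝ)..1, (rodrigues j * rodrigues j).eval x =
      (j.factorial : ℝ) ^ 2 / (2 * j + 1) := by
  have e : ∀ x : ℝ, ((Polynomial.X ^ 2 - Polynomial.X) ^ j *
      Polynomial.C ((2 * j).factorial : ℝ)).eval x =
      ((-1) ^ j * (2 * j).factorial) * (x ^ j * (1 - x) ^ j) := by
    intro x
    rw [← mul_pow, mul_right_comm, ← mul_pow]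
    simp only [Polynomial.eval_mul, Polynomial.eval_pow, Polynomial.eval_sub, Polynomial.eval_X,
      Polynomial.eval_C]
    ring
  rw [integral_rodrigues_mul, iterate_derivative_rodrigues]
  simp only [e]
  rw [intervalIntegral.integral_const_mul, integral_pow_mul_one_sub_pow, ← mul_assoc, ← mul_assoc,
    ← mul_pow, ← two_mul, Nat.factorial_succ]
  push_cast
  field_simp
  norm_num

lemma integral_rodrigues_mul_of_lt {i j : ℕ} (hij : i < j) :
    ∫ x in (0 : ℝ)..1, (rodrigues j * rodrigues i).eval x = 0 := by
  rw [integral_rodrigues_mul, Polynomial.iterate_derivative_eq_zero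
    ((natDegree_rodrigues_le i).trans_lt hij)]
  simp

lemma integral_legPoly_mul (i j : ℕ) :
    ∫ x in (0 : ℝ)..1, (legPoly i).eval x * (legPoly j).eval x = if i = j then 1 else 0 := by
  have e : ∀ x : ℝ, (legPoly i).eval x * (legPoly j).eval x =
      (Real.sqrt (2 * i + 1) / i.factorial * (Real.sqrt (2 * j + 1) / j.factorial)) *
        (rodrigues i * rodrigues j).eval x := by
    intro x
    simp only [legPoly, Polynomial.eval_mul, Polynomial.eval_C]
    ring
  simp only [e]
  rw [intervalIntegral.integral_const_mul]
  rcases lt_trichotomy i j with h | rfl | h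
  · rw [mul_comm (rodrigues i), integral_rodrigues_mul_of_lt h, if_neg h.ne, mul_zero]
  · rw [integral_rodrigues_mul_self, if_pos rfl, div_mul_div_comm,
      Real.mul_self_sqrt (by positivity)]
    field_simp
  · rw [integral_rodrigues_mul_of_lt h, if_neg h.ne', mul_zero]

open scoped unitInterval

/-- The `j`-th shifted Legendre polynomial as a continuous function on the unit interval. -/
noncomputable def legContinuousMap (j : ℕ) : C(I, ℝ) :=
  (legPoly j).toContinuousMapOn I

/-- The `j`-th shifted Legendre polynomial as an element of `L²([0,1])`. -/
noncomputable def legLp (j : ℕ) : Lp ℝ 2 (volume : Measure I) :=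
  ContinuousMap.toLp 2 volume ℝ (legContinuousMap j)

lemma coeFn_legLp (j : ℕ) : legLp j =ᵐ[volume] fun u : I => Leg j u := by
  rw [Leg_eq_eval]
  exact ContinuousMap.coeFn_toLp volume (legContinuousMap j)

lemma orthonormal_legLp : Orthonormal ℝ legLp := by
  rw [orthonormal_iff_ite]
  intro i j
  rw [legLp, legLp, ContinuousMap.inner_toLp]
  simp only [legContinuousMap, Polynomial.toContinuousMapOn_apply, Polynomial.toContinuousMap_apply,
    conj_trivial]
  rw [unitInterval.measurePreserving_coe.integral_comp unitInterval.measurableEmbedding_coe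
    (fun x => (legPoly j).eval x * (legPoly i).eval x), integral_Icc_eq_integral_Ioc,
    ← intervalIntegral.integral_of_le zero_le_one, integral_legPoly_mul]
  simp only [eq_comm]

lemma span_legPoly : Submodule.span ℝ (range legPoly) = ⊤ :=
  Polynomial.Sequence.span ⟨legPoly, degree_legPoly⟩ fun i =>
    (Polynomial.leadingCoeff_ne_zero.mpr fun h => by
      simpa [show legPoly i = 0 from h] using degree_legPoly i).isUnit

lemma span_legLp_topologicalClosure :
    (Submodule.span ℝ (range legLp)).topologicalClosure = ⊤ := by
  have hC : (Submodule.span ℝ (range legContinuousMap)).topologicalClosure = ⊤ := by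
    have h : Submodule.span ℝ (range legContinuousMap) =
        Subalgebra.toSubmodule (polynomialFunctions I) := by
      have : range legContinuousMap =
          (Polynomial.toContinuousMapOnAlgHom I).toLinearMap '' range legPoly := by
        rw [← range_comp]; rfl
      rw [this, ← Submodule.map_span, span_legPoly, polynomialFunctions]
      rfl
    rw [h, ← SetLike.coe_set_eq]
    exact congrArg (fun A : Subalgebra ℝ C(I, ℝ) => (A : Set C(I, ℝ)))
      polynomialFunctions_closure_eq_top'
  convert! (ContinuousMap.toLp_denseRange ℝ (volume : Measure I) ℝ
    (ENNReal.ofNat_ne_top (n := 2))).topologicalClosure_map_submodule hC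
  rw [Submodule.map_span, ← range_comp]
  rfl

/-- The Legendre expansion of a square-integrable function on `[0,1]` converges in `L²`. -/
lemma tendsto_eLpNorm_sub_sum_Leg (k : I → ℝ) (hk : MemLp k 2 volume) :
    Tendsto (fun n => eLpNorm (fun u : I => k u -
      ∑ j ∈ Finset.range n, (∫ v : I, k v * Leg j v) * Leg j u) 2 volume) atTop (nhds 0) := by
  let b : HilbertBasis ℕ ℝ (Lp ℝ 2 (volume : Measure I)) :=
    HilbertBasis.mk orthonormal_legLp span_legLp_topologicalClosure.ge
  have hb : ∀ j, b j = legLp j := fun j => by simp [b]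
  have hcoef : ∀ j, b.repr (hk.toLp k) j = ∫ v : I, k v * Leg j v := by
    intro j
    rw [b.repr_apply_apply, hb, L2.inner_def]
    refine integral_congr_ae ?_
    filter_upwards [hk.coeFn_toLp, coeFn_legLp j] with u h1 h2
    rw [h1, h2]
    simp
  have hsum := (b.hasSum_repr (hk.toLp k)).tendsto_sum_nat
  rw [tendsto_iff_edist_tendsto_0] at hsum
  refine hsum.congr fun n => ?_
  rw [edist_comm, Lp.edist_def]
  refine eLpNorm_congr_ae ?_
  have hae : ∀ᵐ u : I, ∀ j, legLp j u = Leg j u := ae_all_iff.mpr coeFn_legLp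
  have hsm : ∀ᵐ u : I, ∀ j, (b.repr (hk.toLp k) j • b j : Lp ℝ 2 (volume : Measure I)) u =
      b.repr (hk.toLp k) j • b j u := ae_all_iff.mpr fun j => Lp.coeFn_smul _ _
  have hs : ((∑ j ∈ Finset.range n, b.repr (hk.toLp k) j • b j :
      Lp ℝ 2 (volume : Measure I)) : I → ℝ) =ᵐ[volume]
      fun u => ∑ j ∈ Finset.range n,
        (b.repr (hk.toLp k) j • b j : Lp ℝ 2 (volume : Measure I)) u := by
    induction n with
    | zero => exact Lp.coeFn_zero ℝ 2 (volume : Measure I)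
    | succ n ih =>
      simp only [Finset.sum_range_succ]
      filter_upwards [ih, Lp.coeFn_add (∑ j ∈ Finset.range n, b.repr (hk.toLp k) j • b j)
        (b.repr (hk.toLp k) n • b n)] with u h1 h2
      rw [h2, Pi.add_apply, h1]
  filter_upwards [hk.coeFn_toLp, hae, hsm, hs] with u h1 h2 h3 h4
  rw [Pi.sub_apply, h1, h4]
  simp only [h3]
  simp only [hb, h2, hcoef, smul_eq_mul]

open ProbabilityTheory in
/-- The probability integral transform: a continuous distribution function transports its law to
the uniform law on `[0,1]`. -/
lemma map_cdf_eq_restrict_volume (μ : Measure ℝ) [IsProbabilityMeasure μ]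
    (hc : Continuous (cdf μ)) : μ.map (cdf μ) = volume.restrict I := by
  have hprob : IsProbabilityMeasure (μ.map (cdf μ)) :=
    Measure.isProbabilityMeasure_map hc.measurable.aemeasurable
  have hmid : ∀ t ∈ Ioo (0 : ℝ) 1, μ.map (cdf μ) (Iic t) = ENNReal.ofReal t := by
    intro t ht
    obtain ⟨a, ha⟩ := ((tendsto_cdf_atBot μ).eventually (gt_mem_nhds ht.1)).exists
    obtain ⟨c, hct⟩ := ((tendsto_cdf_atTop μ).eventually (lt_mem_nhds ht.2)).exists
    obtain ⟨y, hy⟩ := mem_range_of_exists_le_of_exists_ge hc ⟨a, ha.le⟩ ⟨c, hct.le⟩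
    set S : Set ℝ := cdf μ ⁻¹' Iic t
    have hSc : IsClosed S := isClosed_Iic.preimage hc
    have hSb : BddAbove S := ⟨c, fun x hx => by
      by_contra! hcx
      exact absurd (((monotone_cdf μ) hcx.le).trans hx) (not_le.mpr hct)⟩
    have hyS : y ∈ S := hy.le
    have hmem : sSup S ∈ S := hSc.csSup_mem ⟨y, hyS⟩ hSb
    have hval : cdf μ (sSup S) = t :=
      le_antisymm hmem (hy ▸ monotone_cdf μ (le_csSup hSb hyS))
    have hS : S = Iic (sSup S) :=
      Subset.antisymm (fun x hx => le_csSup hSb hx)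
        fun x hx => ((monotone_cdf μ) hx).trans hmem
    rw [Measure.map_apply hc.measurable measurableSet_Iic, show cdf μ ⁻¹' Iic t = S from rfl, hS,
      ← ofReal_cdf, hval]
  refine Measure.ext_of_Iic _ _ fun t => ?_
  rw [Measure.restrict_apply measurableSet_Iic]
  rcases le_or_gt 1 t with h1 | h1
  · rw [inter_eq_right.mpr fun x hx => hx.2.trans h1, Real.volume_Icc, sub_zero, ENNReal.ofReal_one,
      Measure.map_apply hc.measurable measurableSet_Iic]
    convert! measure_univ (μ := μ)
    exact eq_univ_of_forall fun x => (cdf_le_one μ x).trans h1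
  have hI : ENNReal.ofReal t = volume (Iic t ∩ I) := by
    have : Iic t ∩ I = Icc 0 t := by
      ext x
      exact ⟨fun hx => ⟨hx.2.1, hx.1⟩, fun hx => ⟨hx.2, hx.1, hx.2.trans h1.le⟩⟩
    rw [this, Real.volume_Icc, sub_zero]
  rw [← hI]
  rcases lt_or_ge 0 t with h0 | h0
  · exact hmid t ⟨h0, h1⟩
  rw [ENNReal.ofReal_of_nonpos h0]
  refine le_antisymm (ENNReal.le_of_forall_pos_le_add fun ε hε _ => ?_) zero_le
  have hm : min (ε : ℝ) (1 / 2) ∈ Ioo (0 : ℝ) 1 :=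
    ⟨lt_min hε (by norm_num), (min_le_right _ _).trans_lt (by norm_num)⟩
  calc μ.map (cdf μ) (Iic t) ≤ μ.map (cdf μ) (Iic (min (ε : ℝ) (1 / 2))) :=
        measure_mono (Iic_subset_Iic.mpr (h0.trans hm.1.le))
    _ = ENNReal.ofReal (min (ε : ℝ) (1 / 2)) := hmid _ hm
    _ ≤ ENNReal.ofReal ε := ENNReal.ofReal_le_ofReal (min_le_left _ _)
    _ = 0 + ε := by simp

open ProbabilityTheory in
/-- A continuous distribution function has an almost sure measurable left inverse. -/
lemma exists_measurable_ae_leftInverse_cdf (μ : Measure ℝ) [IsProbabilityMeasure μ]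
    (hc : Continuous (cdf μ)) : ∃ Q : ℝ → ℝ, Measurable Q ∧ ∀ᵐ x ∂μ, Q (cdf μ x) = x := by
  let R : ℝ → EReal := fun u => ⨅ q : ℚ, if u ≤ cdf μ q then ((q : ℝ) : EReal) else ⊤
  refine ⟨fun u => (R u).toReal, (Measurable.iInf fun q =>
    Measurable.ite measurableSet_Iic measurable_const measurable_const).ereal_toReal, ?_⟩
  have hne : ∀ᵐ x ∂μ, ∀ q : ℚ, cdf μ x ≠ cdf μ q := by
    refine ae_all_iff.mpr fun q => ?_
    have h : μ.map (cdf μ) {cdf μ q} = 0 := by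
      rw [map_cdf_eq_restrict_volume μ hc]
      exact measure_singleton _
    rw [Measure.map_apply hc.measurable (measurableSet_singleton _)] at h
    exact measure_eq_zero_iff_ae_notMem.mp h
  filter_upwards [hne] with x hx
  have hle : ∀ q : ℚ, cdf μ x ≤ cdf μ q ↔ x ≤ q := fun q =>
    ⟨fun h => by
      by_contra! hlt
      exact hx q (h.antisymm (monotone_cdf μ hlt.le)), fun h => monotone_cdf μ h⟩
  have hR : R (cdf μ x) = (x : EReal) := by
    refine le_antisymm (le_of_forall_gt fun z hz => ?_) (le_iInf fun q => ?_)
    · obtain ⟨q, hq1, hq2⟩ := EReal.exists_rat_btwn_of_lt hz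
      refine (iInf_le _ q).trans_lt ?_
      rw [if_pos ((hle q).mpr (EReal.coe_le_coe_iff.mp hq1.le))]
      exact hq2
    · split_ifs with h
      · exact EReal.coe_le_coe_iff.mpr ((hle q).mp h)
      · exact le_top
  simp [hR]

open ProbabilityTheory in
lemma distFun_eq_cdf {Ω : Type*} [MeasurableSpace Ω] (P : Measure Ω) [IsProbabilityMeasure P]
    {X : Ω → ℝ} (hX : Measurable X) : distFun P X = cdf (P.map X) := by
  have := Measure.isProbabilityMeasure_map (μ := P) hX.aemeasurable
  ext x
  rw [cdf_eq_real, map_measureReal_apply hX measurableSet_Iic]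
  rfl

lemma continuous_Leg (j : ℕ) : Continuous (Leg j) := by
  rw [Leg_eq_eval]
  exact (legPoly j).continuous

lemma Leg_zero (u : ℝ) : Leg 0 u = 1 := by
  simp [Leg_eq_eval, legPoly_zero]

/-- (LP representation of conditional expectation.) If `X` has a
continuous distribution function and `W` is square integrable, then
`E[W|σ(X)] = E[W] + ∑_{j≥1} E[W·Leg_j(F(X;X))]·Leg_j(F(X;X))`, the series
converging in `L²(P)`. -/
theorem condexp_LP_representation {Ω : Type*} [MeasurableSpace Ω]
    (P : Measure Ω) [IsProbabilityMeasure P] (X : Ω → ℝ) (hX : Measurable X)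
    (hF : Continuous (distFun P X)) (W : Ω → ℝ) (hW : MemLp W 2 P) :
    Tendsto
      (fun n => eLpNorm
        (fun ω =>
          (P[W | MeasurableSpace.comap X Real.measurableSpace]) ω -
            ((∫ ω', W ω' ∂P) +
              ∑ j ∈ Finset.Icc 1 n,
                (∫ ω', W ω' * Leg j (distFun P X (X ω')) ∂P) *
                  Leg j (distFun P X (X ω))))
        2 P)
      atTop (nhds 0) := by
  have := Measure.isProbabilityMeasure_map (μ := P) hX.aemeasurable
  have hm : MeasurableSpace.comap X Real.measurableSpace ≤ ‹MeasurableSpace Ω› := hX.comap_le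
  have hcdf := distFun_eq_cdf P hX
  obtain ⟨Q, hQ, hQX⟩ := exists_measurable_ae_leftInverse_cdf (P.map X) (hcdf ▸ hF)
  replace hQX := ae_of_ae_map hX.aemeasurable hQX
  rw [← hcdf] at hQX
  obtain ⟨h, hh, hcond⟩ := (stronglyMeasurable_condExp (f := W) (μ := P)
    (m := MeasurableSpace.comap X Real.measurableSpace)).exists_eq_measurable_comp
  have hrange : ∀ x, distFun P X x ∈ I := fun x => by
    rw [hcdf]
    exact ⟨ProbabilityTheory.cdf_nonneg _ x, ProbabilityTheory.cdf_le_one _ x⟩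
  let U : Ω → I := fun ω => ⟨distFun P X (X ω), hrange (X ω)⟩
  have hUm : Measurable U := (hF.measurable.comp hX).subtype_mk
  have hU : MeasurePreserving U P volume := by
    refine ⟨hUm, unitInterval.measurableEmbedding_coe.map_injective ?_⟩
    rw [unitInterval.measurePreserving_coe.map_eq,
      Measure.map_map measurable_subtype_coe hUm,
      ← map_cdf_eq_restrict_volume (P.map X) (hcdf ▸ hF), ← hcdf,
      Measure.map_map hF.measurable hX]
    rfl
  let k : I → ℝ := fun u => h (Q u)
  have hkm : StronglyMeasurable k := hh.comp_measurable (hQ.comp measurable_subtype_coe)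
  have hkU : P[W | MeasurableSpace.comap X Real.measurableSpace] =ᵐ[P] k ∘ U := by
    filter_upwards [hQX] with ω hω
    rw [hcond]
    simp only [Function.comp_apply, k, U, hω]
  have hk : MemLp k 2 volume := by
    rw [← hU.map_eq, memLp_map_measure_iff hkm.aestronglyMeasurable hUm.aemeasurable]
    exact (hW.condExp one_le_two).ae_eq hkU
  have hcoef : ∀ j, ∫ ω, W ω * Leg j (distFun P X (X ω)) ∂P = ∫ u : I, k u * Leg j u := by
    intro j
    have hL : StronglyMeasurable[MeasurableSpace.comap X Real.measurableSpace]
        (fun ω => Leg j (distFun P X (X ω))) :=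
      ((continuous_Leg j).comp hF).stronglyMeasurable.comp_measurable (comap_measurable X)
    obtain ⟨C, hC⟩ := isCompact_Icc.exists_bound_of_continuousOn (s := I)
      (continuous_Leg j).continuousOn
    have hint : Integrable (W * fun ω => Leg j (distFun P X (X ω))) P :=
      (hW.integrable one_le_two).mul_bdd (c := C) (hL.mono hm).aestronglyMeasurable
        (ae_of_all _ fun ω => hC _ (hrange _))
    have hpull := condExp_mul_of_stronglyMeasurable_right hL hint (hW.integrable one_le_two)
    calc ∫ ω, W ω * Leg j (distFun P X (X ω)) ∂P
        = ∫ ω, (P[W * fun ω => Leg j (distFun P X (X ω)) |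
            MeasurableSpace.comap X Real.measurableSpace]) ω ∂P := (integral_condExp hm).symm
      _ = ∫ ω, k (U ω) * Leg j (U ω) ∂P := by
        refine integral_congr_ae ?_
        filter_upwards [hpull, hkU] with ω h1 h2
        rw [h1, Pi.mul_apply, h2]
        rfl
      _ = ∫ u : I, k u * Leg j u := by
        rw [← hU.map_eq, integral_map hUm.aemeasurable]
        exact (hkm.mul ((continuous_Leg j).comp
          continuous_subtype_val).stronglyMeasurable).aestronglyMeasurable
  refine ((tendsto_add_atTop_iff_nat 1).mpr (tendsto_eLpNorm_sub_sum_Leg k hk)).congr fun n => ?_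
  have hsm : StronglyMeasurable fun u : I =>
      k u - ∑ j ∈ Finset.range (n + 1), (∫ v : I, k v * Leg j v) * Leg j u :=
    hkm.sub (Finset.stronglyMeasurable_fun_sum _ fun j _ => ((continuous_Leg j).comp
      continuous_subtype_val).stronglyMeasurable.const_mul _)
  rw [← eLpNorm_comp_measurePreserving hsm.aestronglyMeasurable hU]
  refine eLpNorm_congr_ae ?_
  filter_upwards [hkU] with ω hω
  have hzero : ∫ ω, W ω ∂P = ∫ u : I, k u * Leg 0 u := by
    simpa only [Leg_zero, mul_one] using hcoef 0
  simp only [hω, hcoef, hzero, Function.comp_apply, Finset.range_eq_Ico]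
  rw [Finset.sum_eq_sum_Ico_succ_bot n.succ_pos, Leg_zero, mul_one]
  rfl
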